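/- For every integer n ≥ 5 there is no compact right-angled convex hyperbolic n-polyhedron, i.e. no finite intersection of hyperbolic half-spaces with nonempty interior, all of whose dihedral angles are π/2, whose closure in the Klein model is the convex hull of finitely many vertices all lying in the open unit ball. -/

import Mathlib

open scoped BigOperators

noncomputable section

/-- The Minkowski bilinear form `⟨x,y⟩ = -x₀y₀ + x₁y₁ + ⋯ + xₙyₙ` on `ℝ^{n+1}`. -/
def mink {n : ℕ} (x y : Fin (n + 1) → ℝ) : ℝ :=
  -(x 0 * y 0) + ∑ i : Fin n, x i.succ * y i.succ

/-- The hyperboloid model of the hyperbolic space `ℍⁿ`. -/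
def Hyperboloid (n : ℕ) : Set (Fin (n + 1) → ℝ) :=
  {x | mink x x = -1 ∧ 0 < x 0}

/-- The Klein projection `x ↦ (x₁/x₀, …, xₙ/x₀)` of the hyperboloid onto the unit ball. -/
def kleinMap {n : ℕ} (x : Fin (n + 1) → ℝ) : EuclideanSpace ℝ (Fin n) :=
  WithLp.toLp 2 fun i => x i.succ / x 0

/-- Dimension of a subset of a real vector space: the rank of its vector span. -/
def sdim {n : ℕ} (s : Set (EuclideanSpace ℝ (Fin n))) : ℕ :=
  Module.finrank ℝ (vectorSpan ℝ s)

/-- A convex hyperbolic `n`-polyhedron: a finite intersection of hyperbolic half-spaces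
`H_{eᵢ}⁻ = {x : ⟨eᵢ,x⟩ ≤ 0}` (with `⟨eᵢ,eᵢ⟩ = 1`) having nonempty interior
(equivalently, its Klein-model image has nonempty interior in `ℝⁿ`). -/
structure HypPolyhedron (n : ℕ) where
  m : ℕ
  e : Fin m → (Fin (n + 1) → ℝ)
  unit : ∀ i, mink (e i) (e i) = 1
  nonempty_int :
    (interior (kleinMap '' {x ∈ Hyperboloid n | ∀ i, mink (e i) x ≤ 0})).Nonempty

namespace HypPolyhedron

variable {n : ℕ} (P : HypPolyhedron n)

/-- The set of points of the polyhedron in the hyperboloid model. -/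
def carrier : Set (Fin (n + 1) → ℝ) :=
  {x ∈ Hyperboloid n | ∀ i, mink (P.e i) x ≤ 0}

/-- `P̄`: the closure of the Klein-model image of the polyhedron in the closed unit ball. -/
def cl : Set (EuclideanSpace ℝ (Fin n)) :=
  closure (kleinMap '' P.carrier)

/-- The `k`-faces of `P`: the `k`-dimensional (nonempty) exposed faces of `P̄`. -/
def faces (k : ℕ) : Set (Set (EuclideanSpace ℝ (Fin n))) :=
  {F | IsExposed ℝ P.cl F ∧ F.Nonempty ∧ sdim F = k}

/-- `a_k(P)`: the number of `k`-faces of `P`. -/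
def a (k : ℕ) : ℕ := (P.faces k).ncard

/-- Vertices of `P`: the points of `0`-dimensional exposed faces of `P̄`. -/
def verts : Set (EuclideanSpace ℝ (Fin n)) :=
  {v | IsExposed ℝ P.cl {v}}

/-- Ideal vertices: vertices lying on the unit sphere. -/
def idealVerts : Set (EuclideanSpace ℝ (Fin n)) :=
  {v ∈ P.verts | ‖v‖ = 1}

/-- Finite vertices: vertices lying in the open unit ball. -/
def finiteVerts : Set (EuclideanSpace ℝ (Fin n)) :=
  {v ∈ P.verts | ‖v‖ < 1}

/-- `v_∞(P)`: the number of ideal vertices of `P`. -/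
def vInf : ℕ := P.idealVerts.ncard

/-- The bounding hyperplane `H_e` contains the face `F`. -/
def faceInHyperplane (e : Fin (n + 1) → ℝ) (F : Set (EuclideanSpace ℝ (Fin n))) : Prop :=
  ∀ x ∈ P.carrier, kleinMap x ∈ F → mink e x = 0

/-- `P` is right-angled: whenever two distinct bounding hyperplanes both contain an
`(n-2)`-dimensional face of `P`, the corresponding unit normals are orthogonal,
i.e. the dihedral angle is `π/2`. -/
def IsRightAngled : Prop :=
  ∀ i j : Fin P.m, i ≠ j →
    (∃ F ∈ P.faces (n - 2), P.faceInHyperplane (P.e i) F ∧ P.faceInHyperplane (P.e j) F) →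
    mink (P.e i) (P.e j) = 0

/-- `P` has finite volume: `P̄` is the convex hull of its (finitely many) vertices. -/
def FiniteVolume : Prop :=
  P.verts.Finite ∧ P.cl = convexHull ℝ P.verts

/-- `P` is compact: finite volume and all vertices are finite. -/
def IsCompactPoly : Prop :=
  P.FiniteVolume ∧ ∀ v ∈ P.verts, ‖v‖ < 1

/-- `P` is ideal: finite volume and all vertices are ideal. -/
def IsIdeal : Prop :=
  P.FiniteVolume ∧ ∀ v ∈ P.verts, ‖v‖ = 1

end HypPolyhedron

/-- `ν(P) = a_{n-1}(P) + v_∞(P)` ranging over the family `𝒫ⁿ` of finite-volume non-compact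
right-angled convex hyperbolic `n`-polyhedra. -/
def nuSet (n : ℕ) : Set ℕ :=
  {m | ∃ P : HypPolyhedron n,
        P.FiniteVolume ∧ P.IsRightAngled ∧ ¬ P.IsCompactPoly ∧ P.a (n - 1) + P.vInf = m}

/-- `νₙ = sInf {ν(P) : P ∈ 𝒫ⁿ}` (with `sInf ∅ = 0`). -/
def nu (n : ℕ) : ℕ := sInf (nuSet n)

/-! ### Counting two-dimensional faces of a simple polytope -/

/-- Let `V` be the vertices of a simple polytope, each recorded by its set of facets, and let `r`
be the orthogonality of facets.  If neither triangles nor quadrangles occur, then every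
two-dimensional face, recorded by the set `S` of facets containing it, has five vertices. -/
theorem five_le_card_vertices_of_face {ι : Type*} [DecidableEq ι] (V : Finset (Finset ι))
    (r : ι → ι → Prop)
    (horth : ∀ A ∈ V, ∀ i ∈ A, ∀ j ∈ A, i ≠ j → r i j)
    (hedge : ∀ A ∈ V, ∀ i ∈ A, ∃ k, k ∉ A ∧ insert k (A.erase i) ∈ V)
    (hmax : ∀ A ∈ V, ∀ k, k ∉ A → ∃ j ∈ A, ¬ r k j)
    (hquad : ∀ A ∈ V, ∀ a ∈ A, ∀ b ∈ A, a ≠ b → ∀ c, c ∉ A → ∀ d, d ∉ A →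
      (∀ s ∈ A, s ≠ a → r c s) → (∀ s ∈ A, s ≠ b → r d s) → ¬ r c d)
    (S A : Finset ι) (hA : A ∈ V) (hS : S ⊆ A) (hcard : A.card = S.card + 2) :
    5 ≤ (V.filter (S ⊆ ·)).card := by
  have step : ∀ a b, a ≠ b → a ∉ S → b ∉ S → insert a (insert b S) ∈ V →
      ∃ c, c ∉ S ∧ c ≠ a ∧ c ≠ b ∧ insert b (insert c S) ∈ V := by
    intro a b hab ha hb hV
    obtain ⟨k, hk, hkV⟩ := hedge _ hV a (by simp)
    simp only [Finset.mem_insert, not_or] at hk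
    refine ⟨k, hk.2.2, hk.1, hk.2.1, ?_⟩
    rw [Finset.erase_insert (by simp [hab, ha]), Finset.insert_comm] at hkV
    exact hkV
  obtain ⟨a, b, hab, hdiff⟩ : ∃ a b, a ≠ b ∧ A \ S = {a, b} := by
    rw [← Finset.card_eq_two, Finset.card_sdiff_of_subset hS]; omega
  have ha : a ∈ A \ S := by simp [hdiff]
  have hb : b ∈ A \ S := by simp [hdiff]
  rw [Finset.mem_sdiff] at ha hb
  have hAeq : A = insert a (insert b S) := by
    rw [← Finset.sdiff_union_of_subset hS, hdiff]; ext; simp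
  obtain ⟨ha, haS⟩ := ha
  obtain ⟨hb, hbS⟩ := hb
  rw [hAeq] at hA
  clear hAeq hdiff ha hb hcard hS
  obtain ⟨c, hcS, hca, hcb, h1⟩ := step a b hab haS hbS hA
  obtain ⟨d, hdS, hdb, hdc, h2⟩ := step b c hcb.symm hbS hcS h1
  obtain ⟨f, hfS, hfc, hfd, h3⟩ := step c d hdc.symm hcS hdS h2
  obtain ⟨g, hgS, hgb, hga, h4⟩ := step b a hab.symm hbS haS (by rwa [Finset.insert_comm])
  have hda : d ≠ a := by
    rintro rfl
    obtain ⟨j, hj, hr⟩ := hmax _ hA c (by simp [*])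
    simp only [Finset.mem_insert] at hj
    apply hr
    rcases hj with rfl | hj
    · exact horth _ h2 _ (by simp) _ (by simp) hdc.symm
    · exact horth _ h1 _ (by simp) _ (by rcases hj with h | h <;> simp [h]) (by
        rintro rfl; rcases hj with h | h <;> contradiction)
  have hfb : f ≠ b := by
    rintro rfl
    obtain ⟨j, hj, hr⟩ := hmax _ h1 d (by simp [*])
    simp only [Finset.mem_insert] at hj
    apply hr
    rcases hj with rfl | hj
    · exact horth _ h3 _ (by simp) _ (by simp) hdb
    · exact horth _ h2 _ (by simp) _ (by rcases hj with h | h <;> simp [h]) (by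
        rintro rfl; rcases hj with h | h <;> contradiction)
  have hfa : f ≠ a := by
    rintro rfl
    refine hquad _ hA f (by simp) b (by simp) hab c (by simp [*]) d (by simp [*]) ?_ ?_
      (horth _ h2 _ (by simp) _ (by simp) hdc.symm)
    · intro s hs hsf
      simp only [Finset.mem_insert] at hs
      exact horth _ h1 _ (by simp) _ (by rcases hs with h | h | h <;> simp_all) (by
        rintro rfl; rcases hs with h | h | h <;> contradiction)
    · intro s hs hsf
      simp only [Finset.mem_insert] at hs
      exact horth _ h3 _ (by simp) _ (by rcases hs with h | h | h <;> simp_all) (by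
        rintro rfl; rcases hs with h | h | h <;> contradiction)
  set v0 := insert a (insert b S) with hv0
  set v1 := insert b (insert c S) with hv1
  set v2 := insert c (insert d S) with hv2
  set v3 := insert d (insert f S) with hv3
  set v4 := insert a (insert g S) with hv4
  have a0 : a ∈ v0 := by simp [hv0]
  have b0 : b ∈ v0 := by simp [hv0]
  have b1 : b ∈ v1 := by simp [hv1]
  have c2 : c ∈ v2 := by simp [hv2]
  have a4 : a ∈ v4 := by simp [hv4]
  have a1 : a ∉ v1 := by simp [hv1, hab, hca.symm, haS]
  have a2 : a ∉ v2 := by simp [hv2, hda.symm, hca.symm, haS]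
  have a3 : a ∉ v3 := by simp [hv3, hda.symm, hfa.symm, haS]
  have b4 : b ∉ v4 := by simp [hv4, hab.symm, hgb.symm, hbS]
  have b2 : b ∉ v2 := by simp [hv2, hcb.symm, hdb.symm, hbS]
  have b3 : b ∉ v3 := by simp [hv3, hfb.symm, hdb.symm, hbS]
  have c3 : c ∉ v3 := by simp [hv3, hfc.symm, hdc.symm, hcS]
  have hsub : ({v0, v1, v2, v3, v4} : Finset (Finset ι)) ⊆ V.filter (S ⊆ ·) := by
    intro B hB
    simp only [Finset.mem_insert, Finset.mem_singleton] at hB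
    rw [Finset.mem_filter]
    rcases hB with rfl | rfl | rfl | rfl | rfl
    all_goals
      refine ⟨by assumption, fun s hs => ?_⟩
      simp [hv0, hv1, hv2, hv3, hv4, hs]
  refine le_trans (le_of_eq ?_) (Finset.card_le_card hsub)
  rw [Finset.card_insert_of_notMem, Finset.card_insert_of_notMem, Finset.card_insert_of_notMem,
    Finset.card_insert_of_notMem, Finset.card_singleton]
  all_goals
    simp only [Finset.mem_insert, Finset.mem_singleton, not_or]
    clear hsub hquad hmax hedge horth step
    clear_value v0 v1 v2 v3 v4
    clear hv0 hv1 hv2 hv3 hv4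
    grind only

/-- Local extrema on two-dimensional faces are unique, so there are at least as many faces as
pairs of descending edges. -/
theorem sum_choose_two_le_card_faces {ι : Type*} [DecidableEq ι] (n : ℕ)
    (V : Finset (Finset ι)) (hcard : ∀ A ∈ V, A.card = n) (D : Finset ι → Finset ι)
    (hD : ∀ A ∈ V, D A ⊆ A)
    (huniq : ∀ A ∈ V, ∀ B ∈ V, ∀ S, S ⊆ A → S ⊆ B → A \ S ⊆ D A → B \ S ⊆ D B → A = B) :
    ∑ A ∈ V, (D A).card.choose 2 ≤ (V.biUnion (Finset.powersetCard (n - 2))).card := by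
  let T : Finset ι → Finset (Finset ι) := fun A => (Finset.powersetCard 2 (D A)).image (A \ ·)
  have hT : ∀ A ∈ V, (T A).card = (D A).card.choose 2 := by
    intro A hA
    rw [Finset.card_image_of_injOn, Finset.card_powersetCard]
    intro Q hQ R hR h
    rw [Finset.mem_coe, Finset.mem_powersetCard] at hQ hR
    have hQ' := hQ.1.trans (hD A hA)
    have hR' := hR.1.trans (hD A hA)
    have h' : A \ Q = A \ R := h
    rw [← Finset.sdiff_sdiff_eq_self hQ', h', Finset.sdiff_sdiff_eq_self hR']
  have hmem : ∀ A ∈ V, ∀ S ∈ T A, S ⊆ A ∧ A \ S ⊆ D A ∧ S.card = n - 2 := by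
    intro A hA S hS
    obtain ⟨Q, hQ, rfl⟩ := Finset.mem_image.1 hS
    rw [Finset.mem_powersetCard] at hQ
    have hQ' := hQ.1.trans (hD A hA)
    refine ⟨Finset.sdiff_subset, ?_, ?_⟩
    · rw [Finset.sdiff_sdiff_eq_self hQ']; exact hQ.1
    · rw [Finset.card_sdiff_of_subset hQ', hQ.2, hcard A hA]
  rw [← Finset.sum_congr rfl hT, ← Finset.card_biUnion]
  · apply Finset.card_le_card
    intro S hS
    obtain ⟨A, hA, hS⟩ := Finset.mem_biUnion.1 hS
    obtain ⟨h1, -, h3⟩ := hmem A hA S hS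
    exact Finset.mem_biUnion.2 ⟨A, hA, Finset.mem_powersetCard.2 ⟨h1, h3⟩⟩
  · intro A hA B hB hAB
    refine Finset.disjoint_left.2 fun S hSA hSB => hAB ?_
    obtain ⟨h1, h2, -⟩ := hmem A hA S hSA
    obtain ⟨h3, h4, -⟩ := hmem B hB S hSB
    exact huniq A hA B hB S h1 h3 h2 h4

theorem two_mul_choose_two_le {n d u : ℕ} (hn : 5 ≤ n) (h : d + u = n) :
    2 * n.choose 2 ≤ 5 * (d.choose 2 + u.choose 2) := by
  have key : ∀ k : ℕ, ((k.choose 2 : ℕ) : ℤ) * 2 = k * (k - 1) := by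
    intro k
    cases k with
    | zero => simp
    | succ k =>
      rw [Nat.choose_two_right, Nat.add_sub_cancel]
      have h2 : (k + 1) * k / 2 * 2 = (k + 1) * k :=
        Nat.div_mul_cancel (by rw [mul_comm]; exact (Nat.even_mul_succ_self k).two_dvd)
      have h3 : (((k + 1) * k / 2 * 2 : ℕ) : ℤ) = (((k + 1) * k : ℕ) : ℤ) := by rw [h2]
      push_cast at h3 ⊢
      linarith
  have h1 := key n
  have h2 := key d
  have h3 := key u
  zify
  have hn' : (n : ℤ) = d + u := by rw [← h]; push_cast; ring
  suffices h : (0 : ℤ) ≤ n * (n - 6) + 5 * ((d : ℤ) - u) ^ 2 by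
    rw [hn'] at h1 h
    nlinarith
  rcases Nat.lt_or_ge n 6 with h6 | h6
  · have : n = 5 := by omega
    subst this
    have : (1 : ℤ) ≤ ((d : ℤ) - u) ^ 2 := by
      have : (d : ℤ) - u ≠ 0 := by omega
      have := sq_pos_of_ne_zero this
      omega
    push_cast
    linarith
  · have : (6 : ℤ) ≤ n := by exact_mod_cast h6
    nlinarith [sq_nonneg ((d : ℤ) - u)]

theorem false_of_simple_polytope_faces {ι : Type*} [DecidableEq ι] (n : ℕ) (hn : 5 ≤ n)
    (V : Finset (Finset ι)) (hcard : ∀ A ∈ V, A.card = n)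
    (hfive : ∀ A ∈ V, ∀ S ⊆ A, S.card = n - 2 → 5 ≤ (V.filter (S ⊆ ·)).card)
    (D U : Finset ι → Finset ι) (hD : ∀ A ∈ V, D A ⊆ A) (hU : ∀ A ∈ V, U A ⊆ A)
    (hDU : ∀ A ∈ V, (D A).card + (U A).card = n)
    (hDuniq : ∀ A ∈ V, ∀ B ∈ V, ∀ S, S ⊆ A → S ⊆ B → A \ S ⊆ D A → B \ S ⊆ D B → A = B)
    (hUuniq : ∀ A ∈ V, ∀ B ∈ V, ∀ S, S ⊆ A → S ⊆ B → A \ S ⊆ U A → B \ S ⊆ U B → A = B)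
    (hextr : ∃ A ∈ V, D A = A) : False := by
  set F := V.biUnion (Finset.powersetCard (n - 2)) with hF
  have h1 : F.card * 5 ≤ V.card * n.choose 2 := by
    have hl : F.card * 5 ≤ ∑ S ∈ F, (V.filter (S ⊆ ·)).card := by
      rw [← smul_eq_mul]
      apply Finset.card_nsmul_le_sum
      intro S hS
      obtain ⟨A, hA, hS⟩ := Finset.mem_biUnion.1 hS
      rw [Finset.mem_powersetCard] at hS
      exact hfive A hA S hS.1 hS.2
    have hr : ∑ A ∈ V, (F.filter (· ⊆ A)).card ≤ V.card * n.choose 2 := by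
      rw [← smul_eq_mul]
      apply Finset.sum_le_card_nsmul
      intro A hA
      rw [← Nat.choose_symm (by omega : 2 ≤ n), ← hcard A hA, ← Finset.card_powersetCard]
      apply Finset.card_le_card
      intro S hS
      obtain ⟨hS, hSA⟩ := Finset.mem_filter.1 hS
      obtain ⟨B, hB, hS⟩ := Finset.mem_biUnion.1 hS
      rw [Finset.mem_powersetCard] at hS ⊢
      exact ⟨hSA, by rw [hS.2, hcard A hA]⟩
    have := Finset.sum_card_bipartiteAbove_eq_sum_card_bipartiteBelow
      (s := F) (t := V) (fun S A : Finset ι => S ⊆ A)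
    exact hl.trans (this.le.trans hr)
  have h2 := sum_choose_two_le_card_faces n V hcard D hD hDuniq
  have h3 := sum_choose_two_le_card_faces n V hcard U hU hUuniq
  have h4 : ∑ _A ∈ V, 2 * n.choose 2 <
      ∑ A ∈ V, 5 * ((D A).card.choose 2 + (U A).card.choose 2) := by
    obtain ⟨A, hA, hDA⟩ := hextr
    refine Finset.sum_lt_sum (fun A hA => two_mul_choose_two_le hn (hDU A hA)) ⟨A, hA, ?_⟩
    have : 0 < n.choose 2 := Nat.choose_pos (by omega)
    rw [hDA, hcard A hA]
    omega
  rw [← Finset.mul_sum V (fun A => _ + _), Finset.sum_add_distrib, Finset.sum_const,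
    smul_eq_mul] at h4
  rw [← hF] at h2 h3
  nlinarith

/-! ### The Minkowski form -/

section Minkowski

variable {n : ℕ}

/-- The Minkowski form as a bilinear form. -/
def minkBilin (n : ℕ) : LinearMap.BilinForm ℝ (Fin (n + 1) → ℝ) :=
  LinearMap.mk₂ ℝ mink
    (fun x y z => by simp only [mink, Pi.add_apply, add_mul, Finset.sum_add_distrib]; ring)
    (fun c x y => by
      simp only [mink, Pi.smul_apply, smul_eq_mul, mul_assoc, ← Finset.mul_sum]; ring)
    (fun x y z => by simp only [mink, Pi.add_apply, mul_add, Finset.sum_add_distrib]; ring)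
    (fun c x y => by
      simp only [mink, Pi.smul_apply, smul_eq_mul, mul_left_comm _ c, ← Finset.mul_sum]; ring)

theorem minkBilin_apply (x y : Fin (n + 1) → ℝ) : minkBilin n x y = mink x y := rfl

theorem mink_comm (x y : Fin (n + 1) → ℝ) : mink x y = mink y x := by
  simp only [mink, mul_comm]

theorem mink_add_right (x y z : Fin (n + 1) → ℝ) : mink x (y + z) = mink x y + mink x z :=
  map_add (minkBilin n x) y z

theorem mink_sub_right (x y z : Fin (n + 1) → ℝ) : mink x (y - z) = mink x y - mink x z :=
  map_sub (minkBilin n x) y z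

theorem mink_smul_right (c : ℝ) (x y : Fin (n + 1) → ℝ) : mink x (c • y) = c * mink x y :=
  map_smul (minkBilin n x) c y

theorem mink_neg_right (x y : Fin (n + 1) → ℝ) : mink x (-y) = -mink x y :=
  map_neg (minkBilin n x) y

theorem mink_zero_right (x : Fin (n + 1) → ℝ) : mink x 0 = 0 :=
  map_zero (minkBilin n x)

theorem mink_sum_right {ι : Type*} (s : Finset ι) (f : ι → Fin (n + 1) → ℝ)
    (x : Fin (n + 1) → ℝ) : mink x (∑ i ∈ s, f i) = ∑ i ∈ s, mink x (f i) :=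
  map_sum (minkBilin n x) f s

theorem mink_add_left (x y z : Fin (n + 1) → ℝ) : mink (x + y) z = mink x z + mink y z := by
  rw [mink_comm, mink_add_right, mink_comm z x, mink_comm z y]

theorem mink_sub_left (x y z : Fin (n + 1) → ℝ) : mink (x - y) z = mink x z - mink y z := by
  rw [mink_comm, mink_sub_right, mink_comm z x, mink_comm z y]

theorem mink_smul_left (c : ℝ) (x y : Fin (n + 1) → ℝ) : mink (c • x) y = c * mink x y := by
  rw [mink_comm, mink_smul_right, mink_comm]

theorem mink_zero_left (x : Fin (n + 1) → ℝ) : mink 0 x = 0 := by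
  rw [mink_comm, mink_zero_right]

theorem mink_sum_left {ι : Type*} (s : Finset ι) (f : ι → Fin (n + 1) → ℝ)
    (x : Fin (n + 1) → ℝ) : mink (∑ i ∈ s, f i) x = ∑ i ∈ s, mink (f i) x := by
  rw [mink_comm, mink_sum_right]; simp only [mink_comm]

theorem mink_self_eq (x : Fin (n + 1) → ℝ) :
    mink x x = -(x 0) ^ 2 + ∑ i : Fin n, x i.succ ^ 2 := by
  simp only [mink, sq]

theorem eq_zero_of_forall_mink_eq_zero {x : Fin (n + 1) → ℝ} (h : ∀ y, mink x y = 0) :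
    x = 0 := by
  have h0 : x 0 = 0 := by
    have := h (Pi.single 0 1)
    simpa [mink, Pi.single_apply, Fin.succ_ne_zero] using this
  ext i
  refine Fin.cases h0 (fun j => ?_) i
  have := h (Pi.single j.succ 1)
  simpa [mink, Pi.single_apply, (Fin.succ_ne_zero j).symm] using this

/-- Vectors orthogonal to a timelike vector are spacelike. -/
theorem mink_self_pos_of_orthogonal {x u : Fin (n + 1) → ℝ} (hx : mink x x < 0)
    (hux : mink u x = 0) (hu : u ≠ 0) : 0 < mink u u := by
  by_contra! hneg
  rw [mink_self_eq] at hx hneg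
  have hcs := Finset.sum_mul_sq_le_sq_mul_sq Finset.univ (fun i : Fin n => u i.succ)
    (fun i : Fin n => x i.succ)
  have hux' : ∑ i : Fin n, u i.succ * x i.succ = u 0 * x 0 := by
    rw [mink] at hux; linarith
  rw [hux'] at hcs
  have hU : 0 ≤ ∑ i : Fin n, u i.succ ^ 2 := Finset.sum_nonneg fun i _ => sq_nonneg _
  have hX : 0 ≤ ∑ i : Fin n, x i.succ ^ 2 := Finset.sum_nonneg fun i _ => sq_nonneg _
  have hu0 : u 0 ^ 2 = 0 := by
    have : u 0 ^ 2 * (x 0 ^ 2 - ∑ i : Fin n, x i.succ ^ 2) ≤ 0 := by nlinarith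
    nlinarith [sq_nonneg (u 0)]
  have hU0 : ∑ i : Fin n, u i.succ ^ 2 = 0 := by linarith
  apply hu
  ext i
  refine Fin.cases (by simpa using hu0) (fun j => ?_) i
  simpa using (Finset.sum_eq_zero_iff_of_nonneg (fun i _ => sq_nonneg _)).1 hU0 j
    (Finset.mem_univ j)

theorem exists_ne_zero_forall_mink_eq_zero {ι : Type*} (s : Finset ι) (hs : s.card ≤ n)
    (e : ι → Fin (n + 1) → ℝ) : ∃ y, y ≠ 0 ∧ ∀ k ∈ s, mink (e k) y = 0 := by
  let φ : (Fin (n + 1) → ℝ) →ₗ[ℝ] (s → ℝ) := LinearMap.pi fun k => minkBilin n (e k)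
  have hker : LinearMap.ker φ ≠ ⊥ := LinearMap.ker_ne_bot_of_finrank_lt (by simp; omega)
  obtain ⟨y, hy, hy0⟩ := Submodule.exists_mem_ne_zero_of_ne_bot hker
  exact ⟨y, hy0, fun k hk => congrFun (LinearMap.mem_ker.1 hy) ⟨k, hk⟩⟩

/-- A vector which is not a multiple of the unit vector `e` is detected on the orthogonal
complement of `e`. -/
theorem exists_orthogonal_mink_ne_zero {e f : Fin (n + 1) → ℝ} (he : mink e e = 1)
    (hf : f ∉ Submodule.span ℝ {e}) : ∃ d, mink e d = 0 ∧ mink f d ≠ 0 := by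
  have hg : f - mink f e • e ≠ 0 := fun h => hf <| by
    rw [sub_eq_zero.1 h]; exact Submodule.smul_mem _ _ (Submodule.mem_span_singleton_self e)
  obtain ⟨y, hy⟩ : ∃ y, mink (f - mink f e • e) y ≠ 0 := by
    by_contra! h
    exact hg (eq_zero_of_forall_mink_eq_zero h)
  refine ⟨y - mink e y • e, ?_, ?_⟩
  · rw [mink_sub_right, mink_smul_right, he]; ring
  · rw [mink_sub_left, mink_smul_left] at hy
    rw [mink_sub_right, mink_smul_right]
    intro h
    exact hy (by linarith)

theorem linearIndependent_option_of_orthonormal {ι : Type*} (A : Finset ι)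
    {e : ι → Fin (n + 1) → ℝ} (hunit : ∀ i ∈ A, mink (e i) (e i) = 1)
    (horth : ∀ i ∈ A, ∀ j ∈ A, i ≠ j → mink (e i) (e j) = 0) {x : Fin (n + 1) → ℝ}
    (hx : mink x x < 0) (hxA : ∀ i ∈ A, mink (e i) x = 0) :
    LinearIndependent ℝ (fun o : Option A => o.elim x fun i => e i) := by
  refine LinearMap.BilinForm.linearIndependent_of_iIsOrtho (B := minkBilin n) ?_ ?_
  · rw [LinearMap.BilinForm.iIsOrtho_def]
    rintro (_ | i) (_ | j) hij
    · exact absurd rfl hij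
    · rw [minkBilin_apply, mink_comm]; exact hxA j j.2
    · exact hxA i i.2
    · exact horth i i.2 j j.2 fun h => hij (congrArg some (Subtype.ext h))
  · rintro (_ | i)
    · exact hx.ne
    · simp only [Option.elim, minkBilin_apply, hunit i i.2]; exact one_ne_zero

theorem card_le_of_orthonormal {ι : Type*} (A : Finset ι)
    {e : ι → Fin (n + 1) → ℝ} (hunit : ∀ i ∈ A, mink (e i) (e i) = 1)
    (horth : ∀ i ∈ A, ∀ j ∈ A, i ≠ j → mink (e i) (e j) = 0) {x : Fin (n + 1) → ℝ}
    (hx : mink x x < 0) (hxA : ∀ i ∈ A, mink (e i) x = 0) : A.card ≤ n := by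
  have := (linearIndependent_option_of_orthonormal A hunit horth hx hxA).fintype_card_le_finrank
  simpa using this

/-- Expansion in an orthogonal basis of Minkowski space. -/
theorem eq_sum_of_orthonormal {ι : Type*} (A : Finset ι) (hA : A.card = n)
    {e : ι → Fin (n + 1) → ℝ} (hunit : ∀ i ∈ A, mink (e i) (e i) = 1)
    (horth : ∀ i ∈ A, ∀ j ∈ A, i ≠ j → mink (e i) (e j) = 0) {x : Fin (n + 1) → ℝ}
    (hx : mink x x < 0) (hxA : ∀ i ∈ A, mink (e i) x = 0) (y : Fin (n + 1) → ℝ) :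
    y = (mink x y / mink x x) • x + ∑ i ∈ A, mink (e i) y • e i := by
  have hli := linearIndependent_option_of_orthonormal A hunit horth hx hxA
  have hspan := hli.span_eq_top_of_card_eq_finrank' (by simp [hA])
  rw [← sub_eq_zero]
  set r := y - ((mink x y / mink x x) • x + ∑ i ∈ A, mink (e i) y • e i) with hr
  have hrx : mink r x = 0 := by
    rw [mink_comm, hr, mink_sub_right, mink_add_right, mink_smul_right, mink_sum_right,
      Finset.sum_eq_zero, div_mul_cancel₀ _ hx.ne]
    · ring
    · intro i hi
      rw [mink_smul_right, mink_comm x, hxA i hi, mul_zero]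
  have hre : ∀ i ∈ A, mink r (e i) = 0 := by
    intro i hi
    rw [mink_comm, hr, mink_sub_right, mink_add_right, mink_smul_right, mink_sum_right,
      Finset.sum_eq_single_of_mem i hi, hxA i hi, mink_smul_right, hunit i hi]
    · ring
    · intro j hj hji
      rw [mink_smul_right, horth i hi j hj hji.symm, mul_zero]
  refine eq_zero_of_forall_mink_eq_zero fun z => ?_
  have hz : z ∈ Submodule.span ℝ (Set.range fun o : Option A => o.elim x fun i => e i) :=
    hspan ▸ Submodule.mem_top
  have : Submodule.span ℝ (Set.range fun o : Option A => o.elim x fun i => e i) ≤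
      LinearMap.ker (minkBilin n r) := by
    rw [Submodule.span_le]
    rintro _ ⟨_ | i, rfl⟩
    · exact hrx
    · exact hre i i.2
  exact this hz

theorem mink_eq_sum_of_orthonormal {ι : Type*} (A : Finset ι) (hA : A.card = n)
    {e : ι → Fin (n + 1) → ℝ} (hunit : ∀ i ∈ A, mink (e i) (e i) = 1)
    (horth : ∀ i ∈ A, ∀ j ∈ A, i ≠ j → mink (e i) (e j) = 0) {x : Fin (n + 1) → ℝ}
    (hx : mink x x < 0) (hxA : ∀ i ∈ A, mink (e i) x = 0) (y z : Fin (n + 1) → ℝ) :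
    mink y z = mink y x * mink z x / mink x x + ∑ i ∈ A, mink (e i) y * mink (e i) z := by
  conv_lhs => rw [eq_sum_of_orthonormal A hA hunit horth hx hxA y]
  rw [mink_add_left, mink_smul_left, mink_sum_left, mink_comm x y, mink_comm x z]
  simp only [mink_smul_left]
  ring

end Minkowski

/-! ### Polyhedral cones with right dihedral angles -/

theorem exists_exit_time {ι : Type*} (J : Finset ι) (a b : ι → ℝ) (ha : ∀ k ∈ J, a k ≤ 0)
    (hab : ∀ k ∈ J, a k = 0 → b k ≤ 0) (hex : ∃ k ∈ J, 0 < b k) :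
    ∃ t, 0 < t ∧ (∀ k ∈ J, a k + t * b k ≤ 0) ∧
      ∃ k ∈ J, a k < 0 ∧ 0 < b k ∧ a k + t * b k = 0 := by
  obtain ⟨k₀, hk₀, hb₀⟩ := hex
  obtain ⟨k, hk, hmin⟩ := (J.filter (0 < b ·)).exists_min_image (fun k => -a k / b k)
    ⟨k₀, Finset.mem_filter.2 ⟨hk₀, hb₀⟩⟩
  obtain ⟨hkJ, hbk⟩ := Finset.mem_filter.1 hk
  have hak : a k < 0 := (ha k hkJ).lt_of_ne fun h => absurd (hab k hkJ h) (not_le.2 hbk)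
  have ht : 0 < -a k / b k := div_pos (neg_pos.2 hak) hbk
  refine ⟨-a k / b k, ht, fun l hl => ?_, k, hkJ, hak, hbk, ?_⟩
  · rcases lt_or_ge 0 (b l) with hbl | hbl
    · have := (le_div_iff₀ hbl).1 (hmin l (Finset.mem_filter.2 ⟨hl, hbl⟩))
      linarith
    · nlinarith [ha l hl]
  · rw [div_mul_cancel₀ _ hbk.ne']; ring

open Filter Topology in
theorem eventually_add_mul_neg {ι : Type*} (J : Finset ι) (a b : ι → ℝ) :
    ∀ᶠ t in 𝓝[>] (0 : ℝ), ∀ k ∈ J, a k < 0 → a k + t * b k < 0 := by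
  rw [Filter.eventually_all_finset]
  intro k _
  by_cases hk : a k < 0
  · have hc : Tendsto (fun t : ℝ => a k + t * b k) (𝓝[>] 0) (𝓝 (a k + 0 * b k)) :=
      ((by fun_prop : Continuous fun t : ℝ => a k + t * b k).tendsto 0).mono_left
        nhdsWithin_le_nhds
    filter_upwards [hc.eventually_lt_const (by linarith : a k + 0 * b k < 0)] with t ht _
    exact ht
  · exact Eventually.of_forall fun t h => absurd h hk

open Filter Topology in
theorem exists_pos_add_mul_neg {ι : Type*} (J : Finset ι) (a b : ι → ℝ) :
    ∃ t : ℝ, 0 < t ∧ ∀ k ∈ J, a k < 0 → a k + t * b k < 0 := by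
  obtain ⟨t, h, ht⟩ := ((eventually_add_mul_neg J a b).and self_mem_nhdsWithin).exists
  exact ⟨t, ht, h⟩

/-- The unit vectors `e i`, `i ∈ J`, are the outer normals of the facets of a polyhedral cone
with nonempty interior, contained in the open future light cone, without redundant facets, and
with orthogonal facets wherever two of them meet in codimension two. -/
structure IsRightAngledCone {n : ℕ} {ι : Type*} (e : ι → Fin (n + 1) → ℝ) (J : Finset ι) :
    Prop where
  unit : ∀ i ∈ J, mink (e i) (e i) = 1
  interior : ∃ p, ∀ i ∈ J, mink (e i) p < 0
  timelike : ∀ x, x ≠ 0 → (∀ i ∈ J, mink (e i) x ≤ 0) → mink x x < 0 ∧ 0 < x 0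
  irredundant : ∀ i ∈ J, ∃ w, 0 < mink (e i) w ∧ ∀ j ∈ J, j ≠ i → mink (e j) w < 0
  orthogonal : ∀ i ∈ J, ∀ j ∈ J, i ≠ j → ∀ x, x ≠ 0 → (∀ k ∈ J, mink (e k) x ≤ 0) →
    mink (e i) x = 0 → mink (e j) x = 0 →
    (∀ k ∈ J, mink (e k) x = 0 → e k ∈ Submodule.span ℝ {e i, e j}) → mink (e i) (e j) = 0

namespace IsRightAngledCone

variable {n : ℕ} {ι : Type*} {e : ι → Fin (n + 1) → ℝ} {J : Finset ι}

/-- The relative interior of a facet contains a point in general position. -/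
theorem exists_generic_facet_point (h : IsRightAngledCone e J) {i : ι} (hi : i ∈ J)
    {κ : Type*} [Finite κ] (f : κ → Fin (n + 1) → ℝ) (hf : ∀ c, f c ∉ Submodule.span ℝ {e i}) :
    ∃ z, mink (e i) z = 0 ∧ (∀ k ∈ J, k ≠ i → mink (e k) z < 0) ∧ ∀ c, mink (f c) z ≠ 0 := by
  classical
  obtain ⟨p, hp⟩ := h.interior
  obtain ⟨w, hw, hw'⟩ := h.irredundant i hi
  have hpi := hp i hi
  obtain ⟨z, hzi, hz⟩ : ∃ z, mink (e i) z = 0 ∧ ∀ k ∈ J, k ≠ i → mink (e k) z < 0 := by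
    refine ⟨mink (e i) w • p + (-mink (e i) p) • w, ?_, fun k hk hki => ?_⟩
    · simp only [mink_add_right, mink_smul_right]; ring
    · simp only [mink_add_right, mink_smul_right]
      nlinarith [hp k hk, hw' k hk hki]
  obtain ⟨d, hd, hfd⟩ := Module.Dual.exists_forall_mem_ne_zero_of_forall_exists
    (LinearMap.ker (minkBilin n (e i))) (fun c => minkBilin n (f c)) fun c => by
      obtain ⟨d, hd, hd'⟩ := exists_orthogonal_mink_ne_zero (h.unit i hi) (hf c)
      exact ⟨d, hd, hd'⟩
  have hd' : mink (e i) d = 0 := hd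
  have hne : ∀ᶠ t in nhdsWithin (0 : ℝ) (Set.Ioi 0), ∀ c, mink (f c) z + t * mink (f c) d ≠ 0 := by
    rw [Filter.eventually_all]
    intro c
    have hle : nhdsWithin (0 : ℝ) (Set.Ioi 0) ≤ Filter.cofinite :=
      (nhdsWithin_mono (0 : ℝ) (t := {(0 : ℝ)}ᶜ) fun _ hx => ne_of_gt (Set.mem_Ioi.1 hx)).trans
        (nhdsNE_le_cofinite (0 : ℝ))
    have : ∀ᶠ t in nhdsWithin (0 : ℝ) (Set.Ioi 0), t ∉ ({-mink (f c) z / mink (f c) d} : Set ℝ) :=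
      hle (Set.finite_singleton _).compl_mem_cofinite
    filter_upwards [this] with t ht hzero
    apply ht
    have : mink (f c) d ≠ 0 := hfd c
    rw [Set.mem_singleton_iff, eq_div_iff this]
    linarith
  obtain ⟨t, ht, htf⟩ := ((eventually_add_mul_neg J (fun k => mink (e k) z)
    (fun k => mink (e k) d)).and hne).exists
  refine ⟨z + t • d, ?_, fun k hk hki => ?_, fun c => ?_⟩
  · rw [mink_add_right, mink_smul_right, hzi, hd', mul_zero, add_zero]
  · rw [mink_add_right, mink_smul_right]; exact ht k hk (hz k hk hki)
  · rw [mink_add_right, mink_smul_right]; exact htf c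

/-- The normals of distinct facets span obtuse or right angles. -/
theorem mink_nonpos (h : IsRightAngledCone e J) (hn : 2 ≤ n) {i j : ι} (hi : i ∈ J) (hj : j ∈ J)
    (hij : i ≠ j) : mink (e i) (e j) ≤ 0 := by
  classical
  by_contra! hpos
  obtain ⟨w₀, hw₀j, hw₀⟩ := h.irredundant j hj
  have hw₀i := hw₀ i hi hij
  set w := w₀ - mink (e i) w₀ • e i with hw
  have hwe : ∀ k, mink (e k) w = mink (e k) w₀ - mink (e i) w₀ * mink (e i) (e k) := by
    intro k
    rw [hw, mink_sub_right, mink_smul_right, mink_comm (e k) (e i)]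
  have hwi : mink (e i) w = 0 := by rw [hwe, h.unit i hi]; ring
  have hwj : 0 < mink (e j) w := by rw [hwe]; nlinarith
  let f : ι → ι → Fin (n + 1) → ℝ := fun k l => mink (e l) w • e k - mink (e k) w • e l
  obtain ⟨z, hzi, hz, hfz⟩ := h.exists_generic_facet_point hi
    (κ := {q : J × J // f q.1 q.2 ∉ Submodule.span ℝ {e i}})
    (fun q => f q.1.1 q.1.2) fun q => q.2
  obtain ⟨t, ht, hle, k, hk, hkz, hkw, hk0⟩ := exists_exit_time J (fun k => mink (e k) z)
    (fun k => mink (e k) w) (fun k hk => by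
      rcases eq_or_ne k i with rfl | hki
      · exact hzi.le
      · exact (hz k hk hki).le) (fun k hk h0 => by
      rcases eq_or_ne k i with rfl | hki
      · exact hwi.le
      · exact absurd h0 (hz k hk hki).ne) ⟨j, hj, hwj⟩
  have hki : k ≠ i := by rintro rfl; exact hkz.ne hzi
  have hx : ∀ l, mink (e l) (z + t • w) = mink (e l) z + t * mink (e l) w := fun l => by
    rw [mink_add_right, mink_smul_right]
  have hspan : ∀ l ∈ J, mink (e l) (z + t • w) = 0 → e l ∈ Submodule.span ℝ {e i, e k} := by
    intro l hl hl0
    rcases eq_or_ne l i with rfl | hli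
    · exact Submodule.subset_span (by simp)
    have hfl : f k l ∈ Submodule.span ℝ {e i} := by
      by_contra hne
      refine hfz ⟨(⟨k, hk⟩, ⟨l, hl⟩), hne⟩ ?_
      rw [hx] at hl0
      simp only [f, mink_sub_left, mink_smul_left]
      have e1 : mink (e k) z = -(t * mink (e k) w) := by linarith
      have e2 : mink (e l) z = -(t * mink (e l) w) := by linarith
      rw [e1, e2]; ring
    have : e l = (mink (e k) w)⁻¹ • (mink (e l) w • e k - f k l) := by
      simp only [f, sub_sub_cancel, smul_smul, inv_mul_cancel₀ hkw.ne', one_smul]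
    rw [this]
    refine Submodule.smul_mem _ _ (Submodule.sub_mem _ (Submodule.smul_mem _ _
      (Submodule.subset_span (by simp))) (Submodule.span_mono (by simp) hfl))
  have hx0 : z + t • w ≠ 0 := by
    intro hzero
    obtain ⟨y, hy0, hy⟩ := exists_ne_zero_forall_mink_eq_zero {i, k}
      (Finset.card_le_two.trans hn) e
    have hyi := hy i (by simp)
    have hyk := hy k (by simp)
    have hall : ∀ l ∈ J, mink (e l) y = 0 := by
      intro l hl
      have hle : Submodule.span ℝ {e i, e k} ≤ LinearMap.ker (minkBilin n y) := by
        rw [Submodule.span_le]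
        rintro _ (rfl | rfl)
        · simpa [minkBilin_apply, mink_comm y] using hyi
        · simpa [minkBilin_apply, mink_comm y] using hyk
      have := hle (hspan l hl (by rw [hzero, mink_zero_right]))
      rw [LinearMap.mem_ker, minkBilin_apply] at this
      rw [mink_comm, this]
    have h1 := (h.timelike y hy0 fun l hl => (hall l hl).le).2
    have h2 := (h.timelike (-y) (neg_ne_zero.2 hy0) fun l hl => by
      rw [mink_neg_right, hall l hl, neg_zero]).2
    rw [Pi.neg_apply] at h2
    linarith
  have horth := h.orthogonal i hi k hk hki.symm _ hx0 (fun l hl => by rw [hx]; exact hle l hl)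
    (by rw [hx, hzi, hwi]; ring) (by rw [hx]; exact hk0) hspan
  have hkj : k ≠ j := by rintro rfl; exact hpos.ne' horth
  rw [hwe, horth, mul_zero, sub_zero] at hkw
  exact absurd (hw₀ k hk hkj) (not_lt.2 hkw.le)

theorem linearIndependent (h : IsRightAngledCone e J) (hn : 2 ≤ n) {A : Finset ι} (hA : A ⊆ J)
    {x : Fin (n + 1) → ℝ} (hx : mink x x < 0) (hxA : ∀ i ∈ A, mink (e i) x = 0)
    (c : ι → ℝ) (hc : ∑ i ∈ A, c i • e i = 0) : ∀ i ∈ A, c i = 0 := by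
  classical
  obtain ⟨p, hp⟩ := h.interior
  have key : ∀ c : ι → ℝ, ∑ i ∈ A, c i • e i = 0 → ∀ i ∈ A, c i ≤ 0 := by
    intro c hc
    set P := A.filter (0 < c ·)
    set N := A.filter (¬ 0 < c ·)
    set u := ∑ i ∈ P, c i • e i with hu
    have hsplit : u = -∑ i ∈ N, c i • e i := by
      rw [← Finset.sum_filter_add_sum_filter_not A (0 < c ·)] at hc
      exact eq_neg_of_add_eq_zero_left hc
    have huu : mink u u ≤ 0 := by
      conv_lhs => arg 2; rw [hsplit]
      rw [mink_neg_right, mink_sum_right, neg_nonpos]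
      refine Finset.sum_nonneg fun j hj => ?_
      obtain ⟨hjA, hcj⟩ := Finset.mem_filter.1 hj
      rw [mink_smul_right, hu, mink_sum_left]
      refine mul_nonneg_of_nonpos_of_nonpos (not_lt.1 hcj) (Finset.sum_nonpos fun i hi => ?_)
      obtain ⟨hiA, hci⟩ := Finset.mem_filter.1 hi
      rw [mink_smul_left]
      refine mul_nonpos_of_nonneg_of_nonpos hci.le (h.mink_nonpos hn (hA hiA) (hA hjA) ?_)
      rintro rfl
      exact hcj hci
    have hux : mink u x = 0 := by
      rw [hu, mink_sum_left]
      refine Finset.sum_eq_zero fun i hi => ?_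
      rw [mink_smul_left, hxA i (Finset.mem_filter.1 hi).1, mul_zero]
    have hu0 : u = 0 := by
      by_contra hne
      exact absurd (mink_self_pos_of_orthogonal hx hux hne) (not_lt.2 huu)
    intro i hi
    by_contra! hci
    have hneg : mink u p < 0 := by
      rw [hu, mink_sum_left]
      refine Finset.sum_neg' (fun j hj => ?_) ⟨i, Finset.mem_filter.2 ⟨hi, hci⟩, ?_⟩
      · obtain ⟨hjA, hcj⟩ := Finset.mem_filter.1 hj
        rw [mink_smul_left]
        exact (mul_neg_of_pos_of_neg hcj (hp j (hA hjA))).le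
      · rw [mink_smul_left]
        exact mul_neg_of_pos_of_neg hci (hp i (hA hi))
    rw [hu0, mink_zero_left] at hneg
    exact lt_irrefl _ hneg
  intro i hi
  refine le_antisymm (key c hc i hi) ?_
  have := key (-c) (by simp [hc]) i hi
  simpa using this

/-- The normals of facets through a common point take arbitrary values. -/
theorem exists_forall_mink_eq (h : IsRightAngledCone e J) (hn : 2 ≤ n) {A : Finset ι} (hA : A ⊆ J)
    {x : Fin (n + 1) → ℝ} (hx : mink x x < 0) (hxA : ∀ i ∈ A, mink (e i) x = 0) (c : ι → ℝ) :
    ∃ y, ∀ i ∈ A, mink (e i) y = c i := by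
  classical
  let φ : (Fin (n + 1) → ℝ) →ₗ[ℝ] (A → ℝ) := LinearMap.pi fun k => minkBilin n (e k)
  have hsurj : LinearMap.range φ = ⊤ := by
    by_contra hne
    obtain ⟨g, hg0, hg⟩ := Submodule.exists_le_ker_of_lt_top _ (lt_top_iff_ne_top.2 hne)
    let b : ι → ℝ := fun i => if hi : i ∈ A then g (Pi.single ⟨i, hi⟩ 1) else 0
    have hgb : ∀ v : A → ℝ, g v = ∑ i : A, v i * b i := by
      intro v
      conv_lhs => rw [pi_eq_sum_univ' v]
      simp [b, map_sum]
    have hsum : ∑ i ∈ A, b i • e i = 0 := by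
      refine eq_zero_of_forall_mink_eq_zero fun y => ?_
      have h0 : g (φ y) = 0 := hg ⟨y, rfl⟩
      rw [hgb] at h0
      rw [mink_sum_left, ← Finset.sum_coe_sort A]
      simp only [mink_smul_left]
      rw [← h0]
      exact Finset.sum_congr rfl fun i _ => mul_comm _ _
    have hb := h.linearIndependent hn hA hx hxA b hsum
    apply hg0
    ext v
    simp [hgb, hb]
  obtain ⟨y, hy⟩ := LinearMap.range_eq_top.1 hsurj fun k => c k
  exact ⟨y, fun i hi => congrFun hy ⟨i, hi⟩⟩

/-- Facets through a common point are orthogonal. -/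
theorem mink_eq_zero (h : IsRightAngledCone e J) (hn : 2 ≤ n) {x : Fin (n + 1) → ℝ} (hx0 : x ≠ 0)
    (hx : ∀ k ∈ J, mink (e k) x ≤ 0) {i j : ι} (hi : i ∈ J) (hj : j ∈ J) (hij : i ≠ j)
    (hix : mink (e i) x = 0) (hjx : mink (e j) x = 0) : mink (e i) (e j) = 0 := by
  classical
  have hxx := (h.timelike x hx0 hx).1
  obtain ⟨y, hy⟩ := h.exists_forall_mink_eq hn (Finset.filter_subset (fun k => mink (e k) x = 0) J)
    hxx (fun k hk => (Finset.mem_filter.1 hk).2) (fun k => if k = i ∨ k = j then 0 else -1)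
  simp only [Finset.mem_filter, and_imp] at hy
  obtain ⟨t, ht, hneg⟩ := exists_pos_add_mul_neg J (fun k => mink (e k) x) (fun k => mink (e k) y)
  have hval : ∀ k, mink (e k) (x + t • y) = mink (e k) x + t * mink (e k) y := fun k => by
    rw [mink_add_right, mink_smul_right]
  have hyi := hy i hi hix
  have hyj := hy j hj hjx
  simp only [true_or, or_true, if_true] at hyi hyj
  have hactive : ∀ k ∈ J, k ≠ i → k ≠ j → mink (e k) (x + t • y) < 0 := by
    intro k hk hki hkj
    rw [hval]
    rcases (hx k hk).lt_or_eq with hlt | heq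
    · exact hneg k hk hlt
    · rw [heq, hy k hk heq, if_neg (by simp [hki, hkj])]; linarith
  have hi0 : mink (e i) (x + t • y) = 0 := by rw [hval, hix, hyi]; ring
  have hj0 : mink (e j) (x + t • y) = 0 := by rw [hval, hjx, hyj]; ring
  refine h.orthogonal i hi j hj hij (x + t • y) ?_ ?_ hi0 hj0 ?_
  · intro hzero
    have hyneg : ∀ k ∈ J, mink (e k) (-x) ≤ 0 := by
      intro k hk
      by_cases hki : k = i
      · rw [hki, mink_neg_right, hix, neg_zero]
      by_cases hkj : k = j
      · rw [hkj, mink_neg_right, hjx, neg_zero]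
      · have := hactive k hk hki hkj
        rw [hzero, mink_zero_right] at this
        exact absurd this (lt_irrefl _)
    have h1 := (h.timelike x hx0 hx).2
    have h2 := (h.timelike (-x) (neg_ne_zero.2 hx0) hyneg).2
    rw [Pi.neg_apply] at h2
    linarith
  · intro k hk
    by_cases hki : k = i
    · rw [hki, hi0]
    by_cases hkj : k = j
    · rw [hkj, hj0]
    · exact (hactive k hk hki hkj).le
  · intro k hk hk0
    by_cases hki : k = i
    · exact Submodule.subset_span (by simp [hki])
    by_cases hkj : k = j
    · exact Submodule.subset_span (by simp [hkj])
    · exact absurd hk0 (hactive k hk hki hkj).ne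

/-- A ray leaving a point of the cone in an orthogonal direction hits another facet. -/
theorem exists_exit (h : IsRightAngledCone e J) {x u : Fin (n + 1) → ℝ} (hx0 : x ≠ 0)
    (hx : ∀ k ∈ J, mink (e k) x ≤ 0) (hux : mink u x = 0) (hu0 : u ≠ 0)
    (hu : ∀ k ∈ J, mink (e k) x = 0 → mink (e k) u ≤ 0) :
    ∃ t : ℝ, 0 < t ∧ x + t • u ≠ 0 ∧ (∀ k ∈ J, mink (e k) (x + t • u) ≤ 0) ∧
      ∃ k ∈ J, mink (e k) x < 0 ∧ mink (e k) (x + t • u) = 0 := by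
  have hxx := (h.timelike x hx0 hx).1
  have hex : ∃ k ∈ J, 0 < mink (e k) u := by
    by_contra! hle
    exact absurd (h.timelike u hu0 hle).1 (mink_self_pos_of_orthogonal hxx hux hu0).le.not_gt
  obtain ⟨t, ht, hle, k, hk, hkx, -, hk0⟩ := exists_exit_time J (fun k => mink (e k) x)
    (fun k => mink (e k) u) hx hu hex
  have hval : ∀ k, mink (e k) (x + t • u) = mink (e k) x + t * mink (e k) u := fun k => by
    rw [mink_add_right, mink_smul_right]
  refine ⟨t, ht, fun hzero => ?_, fun k hk => by rw [hval]; exact hle k hk, k, hk, hkx, by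
    rw [hval]; exact hk0⟩
  have : mink (x + t • u) x = mink x x := by
    rw [mink_add_left, mink_smul_left, hux, mul_zero, add_zero]
  rw [hzero, mink_zero_left] at this
  exact hxx.ne this.symm

open Classical in
theorem card_active_le (h : IsRightAngledCone e J) (hn : 2 ≤ n) {x : Fin (n + 1) → ℝ}
    (hx0 : x ≠ 0) (hx : ∀ k ∈ J, mink (e k) x ≤ 0) :
    (J.filter fun k => mink (e k) x = 0).card ≤ n := by
  refine card_le_of_orthonormal _ (fun i hi => h.unit i (Finset.mem_filter.1 hi).1)
    (fun i hi j hj hij => ?_) (h.timelike x hx0 hx).1 fun i hi => (Finset.mem_filter.1 hi).2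
  rw [Finset.mem_filter] at hi hj
  exact h.mink_eq_zero hn hx0 hx hi.1 hj.1 hij hi.2 hj.2

open Classical in
theorem exists_card_active_eq (h : IsRightAngledCone e J) (hn : 2 ≤ n) :
    ∃ x, x ≠ 0 ∧ (∀ k ∈ J, mink (e k) x ≤ 0) ∧
      (J.filter fun k => mink (e k) x = 0).card = n := by
  suffices key : ∀ m ≤ n, ∃ x, x ≠ 0 ∧ (∀ k ∈ J, mink (e k) x ≤ 0) ∧
      m ≤ (J.filter fun k => mink (e k) x = 0).card by
    obtain ⟨x, hx0, hx, hcard⟩ := key n le_rfl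
    exact ⟨x, hx0, hx, le_antisymm (h.card_active_le hn hx0 hx) hcard⟩
  intro m
  induction m with
  | zero =>
    intro _
    obtain ⟨p, hp⟩ := h.interior
    by_cases hp0 : p = 0
    · refine ⟨Pi.single 0 1, by simp, fun k hk => ?_, Nat.zero_le _⟩
      have := hp k hk
      rw [hp0, mink_zero_right] at this
      exact absurd this (lt_irrefl _)
    · exact ⟨p, hp0, fun k hk => (hp k hk).le, Nat.zero_le _⟩
  | succ m ih =>
    intro hm
    obtain ⟨x, hx0, hx, hcard⟩ := ih (by omega)
    rcases hcard.lt_or_eq with hlt | heq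
    · exact ⟨x, hx0, hx, hlt⟩
    obtain ⟨u, hu0, hu⟩ := exists_ne_zero_forall_mink_eq_zero
      (Finset.insertNone (J.filter fun k => mink (e k) x = 0))
      (by rw [Finset.card_insertNone, ← heq]; exact hm) (fun o : Option ι => o.elim x e)
    have hux : mink u x = 0 := by
      rw [mink_comm]; exact hu none (by simp)
    have hue : ∀ k ∈ J, mink (e k) x = 0 → mink (e k) u = 0 := fun k hk hk0 =>
      hu (some k) (by simp [hk, hk0])
    obtain ⟨t, ht, hy0, hy, k, hk, hkx, hky⟩ :=
      h.exists_exit hx0 hx hux hu0 fun k hk hk0 => (hue k hk hk0).le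
    refine ⟨_, hy0, hy, ?_⟩
    rw [heq, Nat.succ_le_iff]
    refine Finset.card_lt_card ⟨fun l hl => ?_, fun hsub => ?_⟩
    · rw [Finset.mem_filter] at hl ⊢
      refine ⟨hl.1, ?_⟩
      rw [mink_add_right, mink_smul_right, hl.2, hue l hl.1 hl.2, mul_zero, add_zero]
    · exact hkx.ne (Finset.mem_filter.1 (hsub (Finset.mem_filter.2 ⟨hk, hky⟩))).2

/-- `x` is the vertex of the cone, normalized by `x 0 = 1`, lying exactly on the facets in `A`. -/
structure IsVertex (e : ι → Fin (n + 1) → ℝ) (J A : Finset ι) (x : Fin (n + 1) → ℝ) : Prop where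
  subset : A ⊆ J
  card : A.card = n
  normalized : x 0 = 1
  nonpos : ∀ k ∈ J, mink (e k) x ≤ 0
  active : ∀ k ∈ J, mink (e k) x = 0 ↔ k ∈ A

open Classical in
theorem exists_isVertex (h : IsRightAngledCone e J) {x : Fin (n + 1) → ℝ} (hx0 : x ≠ 0)
    (hx : ∀ k ∈ J, mink (e k) x ≤ 0) (hcard : (J.filter fun k => mink (e k) x = 0).card = n) :
    ∃ y, IsVertex e J (J.filter fun k => mink (e k) x = 0) y := by
  have hpos := (h.timelike x hx0 hx).2
  refine ⟨(x 0)⁻¹ • x, Finset.filter_subset _ _, hcard, ?_, fun k hk => ?_, fun k hk => ?_⟩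
  · simp [hpos.ne']
  · rw [mink_smul_right]
    exact mul_nonpos_of_nonneg_of_nonpos (inv_pos.2 hpos).le (hx k hk)
  · rw [mink_smul_right, Finset.mem_filter]
    simp [hpos.ne', hk]

namespace IsVertex

variable {A : Finset ι} {x : Fin (n + 1) → ℝ}

theorem ne_zero (hx : IsVertex e J A x) : x ≠ 0 := by
  rintro rfl
  simpa using hx.normalized

theorem timelike (hx : IsVertex e J A x) (h : IsRightAngledCone e J) : mink x x < 0 :=
  (h.timelike x hx.ne_zero hx.nonpos).1

theorem mink_eq_zero (hx : IsVertex e J A x) {i : ι} (hi : i ∈ A) : mink (e i) x = 0 :=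
  (hx.active i (hx.subset hi)).2 hi

theorem orthogonal (hx : IsVertex e J A x) (h : IsRightAngledCone e J) (hn : 2 ≤ n) :
    ∀ i ∈ A, ∀ j ∈ A, i ≠ j → mink (e i) (e j) = 0 := fun _ hi _ hj hij =>
  h.mink_eq_zero hn hx.ne_zero hx.nonpos (hx.subset hi) (hx.subset hj) hij
    (hx.mink_eq_zero hi) (hx.mink_eq_zero hj)

theorem mink_eq_sum (hx : IsVertex e J A x) (h : IsRightAngledCone e J) (hn : 2 ≤ n)
    (y z : Fin (n + 1) → ℝ) :
    mink y z = mink y x * mink z x / mink x x + ∑ i ∈ A, mink (e i) y * mink (e i) z :=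
  mink_eq_sum_of_orthonormal A hx.card (fun i hi => h.unit i (hx.subset hi))
    (hx.orthogonal h hn) (hx.timelike h) (fun _ hi => hx.mink_eq_zero hi) y z

/-- The increment of a linear functional between vertices in terms of edge directions. -/
theorem dual_sub_eq_sum (hx : IsVertex e J A x) (h : IsRightAngledCone e J) (hn : 2 ≤ n)
    (l : Module.Dual ℝ (Fin (n + 1) → ℝ)) {y : Fin (n + 1) → ℝ} (hy : y 0 = 1) :
    l y - l x = ∑ i ∈ A, -mink (e i) y * l (e i 0 • x - e i) := by
  have hsum := eq_sum_of_orthonormal A hx.card (fun i hi => h.unit i (hx.subset hi))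
    (hx.orthogonal h hn) (hx.timelike h) (fun _ hi => hx.mink_eq_zero hi) y
  set c := mink x y / mink x x
  have h0 := congrFun hsum 0
  simp only [Pi.add_apply, Pi.smul_apply, Finset.sum_apply, smul_eq_mul, hx.normalized, hy] at h0
  have hl := congrArg l hsum
  simp only [map_add, map_smul, map_sum, smul_eq_mul] at hl
  have hc : c = 1 - ∑ i ∈ A, mink (e i) y * e i 0 := by linarith
  rw [hl, hc]
  simp only [map_sub, map_smul, smul_eq_mul, mul_sub, Finset.sum_sub_distrib, neg_mul,
    ← mul_assoc, ← Finset.sum_mul, Finset.sum_neg_distrib]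
  ring

theorem exists_edge [DecidableEq ι] (hx : IsVertex e J A x) (h : IsRightAngledCone e J)
    (hn : 2 ≤ n) {i : ι} (hi : i ∈ A) :
    ∃ k, k ∉ A ∧ ∃ y, IsVertex e J (insert k (A.erase i)) y := by
  classical
  have hei : mink (e i) (e i) = 1 := h.unit i (hx.subset hi)
  have hu : ∀ k ∈ A, k ≠ i → mink (e k) (-e i) = 0 := fun k hk hki => by
    rw [mink_neg_right, hx.orthogonal h hn k hk i hi hki, neg_zero]
  have hui : mink (e i) (-e i) = -1 := by rw [mink_neg_right, hei]
  obtain ⟨t, ht, hy0, hy, k, hk, hkx, hky⟩ := h.exists_exit (u := -e i) hx.ne_zero hx.nonpos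
    (by rw [mink_comm, mink_neg_right, mink_comm, hx.mink_eq_zero hi, neg_zero])
    (by
      intro h0
      rw [h0, mink_zero_right] at hui
      norm_num at hui)
    (fun k hk hk0 => by
      rcases eq_or_ne k i with rfl | hki
      · rw [hui]; norm_num
      · exact (hu k ((hx.active k hk).1 hk0) hki).le)
  have hkA : k ∉ A := fun hkA => hkx.ne (hx.mink_eq_zero hkA)
  have hsub : insert k (A.erase i) ⊆ J.filter fun k => mink (e k) (x + t • -e i) = 0 := by
    intro l hl
    rw [Finset.mem_insert, Finset.mem_erase] at hl
    rw [Finset.mem_filter]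
    rcases hl with rfl | ⟨hli, hlA⟩
    · exact ⟨hk, hky⟩
    · refine ⟨hx.subset hlA, ?_⟩
      rw [mink_add_right, mink_smul_right, hx.mink_eq_zero hlA, hu l hlA hli, mul_zero, add_zero]
  have hcard : (insert k (A.erase i)).card = n := by
    rw [Finset.card_insert_of_notMem (by simp [hkA]), Finset.card_erase_of_mem hi, hx.card]
    omega
  have heq := Finset.eq_of_subset_of_card_le hsub
    (by rw [hcard]; exact h.card_active_le hn hy0 hy)
  refine ⟨k, hkA, ?_⟩
  rw [heq] at hcard ⊢
  exact h.exists_isVertex hy0 hy hcard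

end IsVertex

theorem false_of_five_le (h : IsRightAngledCone e J) (hn : 5 ≤ n) : False := by
  classical
  have hn2 : 2 ≤ n := by omega
  set V := J.powerset.filter fun A => ∃ x, IsVertex e J A x with hV
  have memV : ∀ {A x}, IsVertex e J A x → A ∈ V := fun {A x} hx =>
    Finset.mem_filter.2 ⟨Finset.mem_powerset.2 hx.subset, x, hx⟩
  have hex : ∀ A ∈ V, ∃ x, IsVertex e J A x := fun A hA => (Finset.mem_filter.1 hA).2
  choose! X hX using hex
  have hcard : ∀ A ∈ V, A.card = n := fun A hA => (hX A hA).card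
  have hedge : ∀ A ∈ V, ∀ i ∈ A, ∃ k, k ∉ A ∧ insert k (A.erase i) ∈ V := by
    intro A hA i hi
    obtain ⟨k, hk, y, hy⟩ := (hX A hA).exists_edge h hn2 hi
    exact ⟨k, hk, memV hy⟩
  have hXinj : ∀ A ∈ V, ∀ B ∈ V, X A = X B → A = B := by
    intro A hA B hB hAB
    ext k
    by_cases hk : k ∈ J
    · rw [← (hX A hA).active k hk, ← (hX B hB).active k hk, hAB]
    · exact ⟨fun h => absurd ((hX A hA).subset h) hk, fun h => absurd ((hX B hB).subset h) hk⟩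
  obtain ⟨l, hl⟩ := Module.exists_dual_forall_apply_ne_zero (K := ℝ)
    (fun q : {q : V × V // q.1 ≠ q.2} => X q.1.1 - X q.1.2) fun q h0 =>
      q.2 (Subtype.ext (hXinj _ q.1.1.2 _ q.1.2.2 (sub_eq_zero.1 h0)))
  have hlinj : ∀ A ∈ V, ∀ B ∈ V, l (X A) = l (X B) → A = B := by
    intro A hA B hB hAB
    by_contra hne
    refine hl ⟨(⟨A, hA⟩, ⟨B, hB⟩), fun h => hne (congrArg Subtype.val h)⟩ ?_
    rw [map_sub, hAB, sub_self]
  set g : Finset ι → ι → ℝ := fun A i => l (e i 0 • X A - e i) with hg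
  have hsub : ∀ A ∈ V, ∀ B ∈ V, l (X B) - l (X A) = ∑ i ∈ A, -mink (e i) (X B) * g A i :=
    fun A hA B hB => (hX A hA).dual_sub_eq_sum h hn2 l (hX B hB).normalized
  have hneighbor : ∀ A ∈ V, ∀ i ∈ A, ∃ B ∈ V, ∃ c, 0 ≤ c ∧ A ≠ B ∧
      l (X B) - l (X A) = c * g A i := by
    intro A hA i hi
    obtain ⟨k, hk, hB⟩ := hedge A hA i hi
    refine ⟨_, hB, -mink (e i) (X _), neg_nonneg.2 ((hX _ hB).nonpos i ((hX A hA).subset hi)),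
      fun h => hk (h ▸ Finset.mem_insert_self k _), ?_⟩
    rw [hsub A hA _ hB]
    refine Finset.sum_eq_single_of_mem i hi fun j hj hji => ?_
    rw [(hX _ hB).mink_eq_zero (by simp [hj, hji]), neg_zero, zero_mul]
  have hg0 : ∀ A ∈ V, ∀ i ∈ A, g A i ≠ 0 := by
    intro A hA i hi h0
    obtain ⟨B, hB, c, -, hAB, heq⟩ := hneighbor A hA i hi
    rw [h0, mul_zero] at heq
    exact hAB (hlinj A hA B hB (by linarith))
  have hterm : ∀ A ∈ V, ∀ B ∈ V, ∀ i ∈ A, 0 ≤ -mink (e i) (X B) := fun A hA B hB i hi =>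
    neg_nonneg.2 ((hX B hB).nonpos i ((hX A hA).subset hi))
  have hmax : ∀ A ∈ V, ∀ B ∈ V, ∀ S, S ⊆ B → A \ S ⊆ A.filter (g A · < 0) →
      l (X B) ≤ l (X A) := by
    intro A hA B hB S hSB hS
    rw [← sub_nonpos, hsub A hA B hB]
    refine Finset.sum_nonpos fun i hi => ?_
    by_cases hiS : i ∈ S
    · rw [(hX B hB).mink_eq_zero (hSB hiS), neg_zero, zero_mul]
    · exact mul_nonpos_of_nonneg_of_nonpos (hterm A hA B hB i hi)
        (Finset.mem_filter.1 (hS (Finset.mem_sdiff.2 ⟨hi, hiS⟩))).2.le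
  have hmin : ∀ A ∈ V, ∀ B ∈ V, ∀ S, S ⊆ B → A \ S ⊆ A.filter (¬ g A · < 0) →
      l (X A) ≤ l (X B) := by
    intro A hA B hB S hSB hS
    rw [← sub_nonneg, hsub A hA B hB]
    refine Finset.sum_nonneg fun i hi => ?_
    by_cases hiS : i ∈ S
    · rw [(hX B hB).mink_eq_zero (hSB hiS), neg_zero, zero_mul]
    · exact mul_nonneg (hterm A hA B hB i hi)
        (not_lt.1 (Finset.mem_filter.1 (hS (Finset.mem_sdiff.2 ⟨hi, hiS⟩))).2)
  refine false_of_simple_polytope_faces n hn V hcard ?_ (fun A => A.filter (g A · < 0))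
    (fun A => A.filter (¬ g A · < 0)) (fun A _ => Finset.filter_subset _ _)
    (fun A _ => Finset.filter_subset _ _) (fun A hA => ?_) ?_ ?_ ?_
  · intro A hA S hS hScard
    refine five_le_card_vertices_of_face V (fun i j => i ∈ J ∧ mink (e i) (e j) = 0)
      (fun A hA i hi j hj hij => ⟨(hX A hA).subset hi, (hX A hA).orthogonal h hn2 i hi j hj hij⟩)
      hedge (fun A hA k hk => ?_) (fun A hA a ha b hb hab c hc d hd hcs hds hcd => ?_)
      S A hA hS (by rw [hcard A hA, hScard]; omega)
    · by_contra! hall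
      obtain ⟨j, hj⟩ : A.Nonempty := by
        rw [← Finset.card_pos, hcard A hA]; omega
      have hkJ := (hall j hj).1
      have hsum := (hX A hA).mink_eq_sum h hn2 (e k) (e k)
      rw [h.unit k hkJ, Finset.sum_eq_zero fun i hi => by
        rw [mink_comm, (hall i hi).2, zero_mul], add_zero] at hsum
      have := div_nonpos_of_nonneg_of_nonpos (mul_self_nonneg (mink (e k) (X A)))
        ((hX A hA).timelike h).le
      linarith
    · have hcJ := hcd.1
      have hdJ := (hds a ha hab).1
      have hsum := (hX A hA).mink_eq_sum h hn2 (e c) (e d)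
      rw [hcd.2, Finset.sum_eq_zero fun i hi => by
        rcases eq_or_ne i a with rfl | hia
        · rw [mink_comm _ (e d), (hds i hi hab).2, mul_zero]
        · rw [mink_comm _ (e c), (hcs i hi hia).2, zero_mul], add_zero] at hsum
      have h1 : mink (e c) (X A) ≠ 0 := fun h0 => hc (((hX A hA).active c hcJ).1 h0)
      have h2 : mink (e d) (X A) ≠ 0 := fun h0 => hd (((hX A hA).active d hdJ).1 h0)
      exact div_ne_zero (mul_ne_zero h1 h2) ((hX A hA).timelike h).ne hsum.symm
  · rw [Finset.card_filter_add_card_filter_not, hcard A hA]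
  · intro A hA B hB S hSA hSB hSA' hSB'
    exact hlinj A hA B hB (le_antisymm (hmax B hB A hA S hSA hSB') (hmax A hA B hB S hSB hSA'))
  · intro A hA B hB S hSA hSB hSA' hSB'
    exact hlinj A hA B hB (le_antisymm (hmin A hA B hB S hSB hSA') (hmin B hB A hA S hSA hSB'))
  · obtain ⟨x, hx0, hx, hxcard⟩ := h.exists_card_active_eq hn2
    obtain ⟨y, hy⟩ := h.exists_isVertex hx0 hx hxcard
    obtain ⟨A, hA, hAmax⟩ := V.exists_max_image (fun A => l (X A)) ⟨_, memV hy⟩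
    refine ⟨A, hA, Finset.filter_true_of_mem fun i hi => ?_⟩
    obtain ⟨B, hB, c, hc, hAB, heq⟩ := hneighbor A hA i hi
    by_contra! hneg
    have := hAmax B hB
    exact hAB (hlinj A hA B hB (by nlinarith [mul_nonneg hc hneg]))

end IsRightAngledCone

section KleinChart

variable {n : ℕ}

/-- The point of the affine chart `x 0 = 1` of the Klein model with coordinates `y`. -/
def chartLift (y : EuclideanSpace ℝ (Fin n)) : Fin (n + 1) → ℝ := Fin.cons 1 y

/-- The last `n` coordinates of a vector of Minkowski space. -/
def spatial (x : Fin (n + 1) → ℝ) : EuclideanSpace ℝ (Fin n) := WithLp.toLp 2 fun i => x i.succ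

theorem spatial_smul_add_smul (a b : ℝ) (x y : Fin (n + 1) → ℝ) :
    spatial (a • x + b • y) = a • spatial x + b • spatial y := rfl

theorem mink_chartLift (x : Fin (n + 1) → ℝ) (y : EuclideanSpace ℝ (Fin n)) :
    mink x (chartLift y) = inner ℝ (spatial x) y - x 0 := by
  simp only [mink, chartLift, spatial, Fin.cons_zero, Fin.cons_succ, PiLp.inner_apply,
    RCLike.inner_apply, conj_trivial, mul_one]
  rw [neg_add_eq_sub]
  simp only [mul_comm]

theorem mink_chartLift_add (x : Fin (n + 1) → ℝ) (y d : EuclideanSpace ℝ (Fin n)) (t : ℝ) :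
    mink x (chartLift (y + t • d)) = mink x (chartLift y) + t * inner ℝ (spatial x) d := by
  rw [mink_chartLift, mink_chartLift, inner_add_right, inner_smul_right]
  ring

theorem mink_self_chartLift (y : EuclideanSpace ℝ (Fin n)) :
    mink (chartLift y) (chartLift y) = ‖y‖ ^ 2 - 1 := by
  rw [mink_chartLift, show spatial (chartLift y) = y from rfl, real_inner_self_eq_norm_sq]
  rfl

theorem mink_self_eq_norm_sq (x : Fin (n + 1) → ℝ) :
    mink x x = ‖spatial x‖ ^ 2 - x 0 ^ 2 := by
  rw [mink_self_eq, EuclideanSpace.real_norm_sq_eq, neg_add_eq_sub]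
  rfl

theorem continuous_mink_chartLift (x : Fin (n + 1) → ℝ) :
    Continuous fun y : EuclideanSpace ℝ (Fin n) => mink x (chartLift y) := by
  simp only [mink_chartLift]
  fun_prop

theorem smul_chartLift_kleinMap {x : Fin (n + 1) → ℝ} (hx : x 0 ≠ 0) :
    x 0 • chartLift (kleinMap x) = x := by
  ext i
  refine Fin.cases ?_ (fun j => ?_) i
  · simp [chartLift]
  · simp [chartLift, kleinMap, mul_div_cancel₀ _ hx]

theorem kleinMap_smul_chartLift {c : ℝ} (hc : c ≠ 0) (y : EuclideanSpace ℝ (Fin n)) :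
    kleinMap (c • chartLift y) = y := by
  ext i
  simp [chartLift, kleinMap, hc]

theorem linearIndependent_spatial_pair {e f x w : Fin (n + 1) → ℝ}
    {y : EuclideanSpace ℝ (Fin n)} (hex : mink e x < 0) (hfx : mink f x < 0)
    (hew : 0 < mink e w) (hfw : mink f w < 0) (hey : mink e (chartLift y) = 0)
    (hfy : mink f (chartLift y) = 0) :
    LinearIndependent ℝ ![spatial e, spatial f] := by
  rw [LinearIndependent.pair_iff]
  intro a b hab
  have h0 : a • e + b • f = 0 := by
    ext k
    refine Fin.cases ?_ (fun j => congrArg (fun v : EuclideanSpace ℝ (Fin n) => v j) hab) k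
    have h1 : mink (a • e + b • f) (chartLift y) = 0 := by
      rw [mink_add_left, mink_smul_left, mink_smul_left, hey, hfy]
      ring
    rw [mink_chartLift, spatial_smul_add_smul, hab, inner_zero_left, zero_sub,
      neg_eq_zero] at h1
    exact h1
  have hpair : ∀ v, a * mink e v + b * mink f v = 0 := fun v => by
    rw [← mink_smul_left, ← mink_smul_left, ← mink_add_left, h0, mink_zero_left]
  have hx := hpair x
  have hw := hpair w
  have ha : a * (mink e w * mink f x - mink e x * mink f w) = 0 := by
    linear_combination mink f x * hw - mink f w * hx
  have hdet : mink e w * mink f x - mink e x * mink f w < 0 := by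
    nlinarith [mul_pos_of_neg_of_neg hex hfw, mul_neg_of_pos_of_neg hew hfx]
  have ha0 : a = 0 := (mul_eq_zero.1 ha).resolve_right hdet.ne
  refine ⟨ha0, ?_⟩
  rw [ha0, zero_mul, zero_add] at hx
  exact (mul_eq_zero.1 hx).resolve_right hfx.ne

end KleinChart

namespace HypPolyhedron

variable {n : ℕ} {P : HypPolyhedron n}

theorem mem_image_kleinMap_iff {y : EuclideanSpace ℝ (Fin n)} :
    y ∈ kleinMap '' P.carrier ↔ ‖y‖ < 1 ∧ ∀ i, mink (P.e i) (chartLift y) ≤ 0 := by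
  constructor
  · rintro ⟨x, ⟨⟨hxx, hx0⟩, hx⟩, rfl⟩
    have heq := smul_chartLift_kleinMap hx0.ne'
    constructor
    · rw [← heq, mink_smul_left, mink_smul_right, mink_self_chartLift] at hxx
      have : ‖kleinMap x‖ ^ 2 < 1 := by nlinarith [mul_pos hx0 hx0]
      nlinarith [norm_nonneg (kleinMap x)]
    · intro i
      have := hx i
      rw [← heq, mink_smul_right] at this
      nlinarith
  · rintro ⟨hy, hle⟩
    have hpos : 0 < 1 - ‖y‖ ^ 2 := by nlinarith [norm_nonneg y]
    set c := (Real.sqrt (1 - ‖y‖ ^ 2))⁻¹ with hc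
    have hcpos : 0 < c := inv_pos.2 (Real.sqrt_pos.2 hpos)
    refine ⟨c • chartLift y, ⟨⟨?_, ?_⟩, fun i => ?_⟩, kleinMap_smul_chartLift hcpos.ne' y⟩
    · rw [mink_smul_left, mink_smul_right, mink_self_chartLift, ← mul_assoc, hc, ← mul_inv,
        Real.mul_self_sqrt hpos.le]
      field_simp
      ring
    · simpa [chartLift] using hcpos
    · rw [mink_smul_right]
      exact mul_nonpos_of_nonneg_of_nonpos hcpos.le (hle i)

theorem exists_forall_mink_neg (P : HypPolyhedron n) :
    ∃ p : EuclideanSpace ℝ (Fin n), ‖p‖ < 1 ∧ ∀ i, mink (P.e i) (chartLift p) < 0 := by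
  obtain ⟨p, hp⟩ := P.nonempty_int
  have hpS := mem_image_kleinMap_iff.1 (interior_subset hp : p ∈ kleinMap '' P.carrier)
  refine ⟨p, hpS.1, fun i => ?_⟩
  have hev : ∀ᶠ t : ℝ in nhdsWithin 0 (Set.Ioi 0),
      p + t • spatial (P.e i) ∈ kleinMap '' P.carrier := by
    have hcont : Filter.Tendsto (fun t : ℝ => p + t • spatial (P.e i)) (nhds 0)
        (nhds (p + (0 : ℝ) • spatial (P.e i))) :=
      (by fun_prop : Continuous fun t : ℝ => p + t • spatial (P.e i)).tendsto 0
    rw [zero_smul, add_zero] at hcont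
    exact nhdsWithin_le_nhds (hcont.eventually (mem_interior_iff_mem_nhds.1 hp))
  obtain ⟨t, ht, ht0⟩ := (hev.and self_mem_nhdsWithin).exists
  have hle := (mem_image_kleinMap_iff.1 ht).2 i
  rw [mink_chartLift_add, real_inner_self_eq_norm_sq] at hle
  have hunit := P.unit i
  rw [mink_self_eq_norm_sq] at hunit
  have : 0 < t * ‖spatial (P.e i)‖ ^ 2 := mul_pos ht0 (by nlinarith [sq_nonneg (P.e i 0)])
  linarith

theorem IsCompactPoly.cl_subset_ball (hP : P.IsCompactPoly) : P.cl ⊆ Metric.ball 0 1 := by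
  rw [hP.1.2]
  exact convexHull_min (fun v hv => mem_ball_zero_iff.2 (hP.2 v hv)) (convex_ball 0 1)

theorem IsCompactPoly.norm_lt_one (hP : P.IsCompactPoly) {y : EuclideanSpace ℝ (Fin n)}
    (hy : ∀ i, mink (P.e i) (chartLift y) ≤ 0) : ‖y‖ < 1 := by
  set K : Set (EuclideanSpace ℝ (Fin n)) := {y | ∀ i, mink (P.e i) (chartLift y) ≤ 0}
  have hconv : Convex ℝ K := by
    intro x hx y hy a b ha hb hab i
    have : mink (P.e i) (chartLift (a • x + b • y)) =
        a * mink (P.e i) (chartLift x) + b * mink (P.e i) (chartLift y) := by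
      simp only [mink_chartLift, inner_add_right, inner_smul_right]
      linear_combination P.e i 0 * hab
    rw [this]
    nlinarith [hx i, hy i]
  obtain ⟨p, hp, hpK⟩ := P.exists_forall_mink_neg
  by_contra hlt
  have hyball : y ∉ Metric.ball (0 : EuclideanSpace ℝ (Fin n)) 1 := by
    rwa [mem_ball_zero_iff]
  obtain ⟨z, hzK, hzball, hzcl⟩ := hconv.isPreconnected (Metric.ball 0 1) P.clᶜ
    Metric.isOpen_ball isClosed_closure.isOpen_compl
    (fun z _ => by
      by_cases hz : z ∈ P.cl
      · exact Or.inl (hP.cl_subset_ball hz)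
      · exact Or.inr hz)
    ⟨p, fun i => (hpK i).le, mem_ball_zero_iff.2 hp⟩
    ⟨y, hy, fun h => hyball (hP.cl_subset_ball h)⟩
  exact hzcl (subset_closure (mem_image_kleinMap_iff.2 ⟨mem_ball_zero_iff.1 hzball, hzK⟩))

theorem IsCompactPoly.mem_cl_iff (hP : P.IsCompactPoly) {y : EuclideanSpace ℝ (Fin n)} :
    y ∈ P.cl ↔ ∀ i, mink (P.e i) (chartLift y) ≤ 0 := by
  refine ⟨fun hy => ?_, fun hy => subset_closure (mem_image_kleinMap_iff.2
    ⟨hP.norm_lt_one hy, hy⟩)⟩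
  have hclosed : IsClosed {y | ∀ i, mink (P.e i) (chartLift y) ≤ 0} := by
    simp only [Set.ofPred_forall]
    exact isClosed_iInter fun i => isClosed_le (continuous_mink_chartLift _) continuous_const
  exact closure_minimal (fun z hz => (mem_image_kleinMap_iff.1 hz).2) hclosed hy

theorem IsCompactPoly.eq_zero_of_apply_zero_eq_zero (hP : P.IsCompactPoly)
    {x : Fin (n + 1) → ℝ} (hx : ∀ i, mink (P.e i) x ≤ 0) (hx0 : x 0 = 0) : x = 0 := by
  obtain ⟨p, hp, hpK⟩ := P.exists_forall_mink_neg
  have hmink : ∀ i, inner ℝ (spatial (P.e i)) (spatial x) = mink (P.e i) x := by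
    intro i
    have h1 : x = chartLift (spatial x) - chartLift 0 := by
      ext k
      refine Fin.cases ?_ (fun j => ?_) k
      · simp [chartLift, hx0]
      · simp [chartLift, spatial]
    conv_rhs => rw [h1]
    rw [mink_sub_right, mink_chartLift, mink_chartLift, inner_zero_right]
    ring
  have hspatial : spatial x = 0 := by
    by_contra hne
    have hpos : 0 < ‖spatial x‖ := norm_pos_iff.2 hne
    have hnorm : ‖p + (2 / ‖spatial x‖) • spatial x‖ < 1 := hP.norm_lt_one fun i => by
      rw [mink_chartLift_add, hmink]
      nlinarith [hpK i, mul_nonneg (div_pos two_pos hpos).le (neg_nonneg.2 (hx i))]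
    have h2 : ‖(2 / ‖spatial x‖) • spatial x‖ = 2 := by
      rw [norm_smul, norm_div, norm_norm, Real.norm_ofNat, div_mul_cancel₀ _ hpos.ne']
    have h3 := norm_sub_le (p + (2 / ‖spatial x‖) • spatial x) p
    rw [add_sub_cancel_left, h2] at h3
    linarith
  ext k
  refine Fin.cases hx0 (fun j => ?_) k
  exact congrArg (fun v : EuclideanSpace ℝ (Fin n) => v j) hspatial

theorem IsCompactPoly.timelike (hP : P.IsCompactPoly) (hn : n ≠ 0) {x : Fin (n + 1) → ℝ}
    (hne : x ≠ 0) (hx : ∀ i, mink (P.e i) x ≤ 0) : mink x x < 0 ∧ 0 < x 0 := by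
  obtain ⟨p, hp, hpK⟩ := P.exists_forall_mink_neg
  have hpos : 0 < x 0 := by
    by_contra! hle
    have hz : x - x 0 • chartLift p = 0 := by
      refine hP.eq_zero_of_apply_zero_eq_zero (fun i => ?_) (by simp [chartLift])
      rw [mink_sub_right, mink_smul_right]
      nlinarith [hx i, mul_nonneg_of_nonpos_of_nonpos hle (hpK i).le]
    have hx0 : x 0 ≠ 0 := fun h0 => hne (hP.eq_zero_of_apply_zero_eq_zero hx h0)
    by_cases hm : Nonempty (Fin P.m)
    · obtain ⟨i⟩ := hm
      have hxi := hx i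
      rw [sub_eq_zero.1 hz, mink_smul_right] at hxi
      have hxneg : x 0 < 0 := lt_of_le_of_ne hle hx0
      nlinarith [hpK i, mul_pos_of_neg_of_neg hxneg (hpK i)]
    · obtain ⟨k, rfl⟩ := Nat.exists_eq_succ_of_ne_zero hn
      have h1 := hP.eq_zero_of_apply_zero_eq_zero (x := Pi.single 1 1)
        (fun i => absurd ⟨i⟩ hm) (by simp)
      simpa using congrFun h1 1
  refine ⟨?_, hpos⟩
  have heq := smul_chartLift_kleinMap hpos.ne'
  have hnorm : ‖kleinMap x‖ < 1 := hP.norm_lt_one fun i => by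
    have hxi := hx i
    rw [← heq, mink_smul_right] at hxi
    nlinarith
  rw [← heq, mink_smul_left, mink_smul_right, mink_self_chartLift]
  have : ‖kleinMap x‖ ^ 2 < 1 := by nlinarith [norm_nonneg (kleinMap x)]
  nlinarith [mul_pos hpos hpos]

/-- A polyhedron is cut out by a set of half-spaces none of which is redundant. -/
theorem exists_irredundant (P : HypPolyhedron n) :
    ∃ J : Finset (Fin P.m), (∀ x, (∀ i ∈ J, mink (P.e i) x ≤ 0) → ∀ i, mink (P.e i) x ≤ 0) ∧
      ∀ i ∈ J, ∃ w, 0 < mink (P.e i) w ∧ ∀ j ∈ J, j ≠ i → mink (P.e j) w < 0 := by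
  classical
  obtain ⟨J, hJ, hmin⟩ := exists_minimal_of_wellFoundedLT
    (fun J : Finset (Fin P.m) => ∀ x, (∀ i ∈ J, mink (P.e i) x ≤ 0) → ∀ i, mink (P.e i) x ≤ 0)
    ⟨Finset.univ, fun x hx i => hx i (Finset.mem_univ i)⟩
  refine ⟨J, hJ, fun i hi => ?_⟩
  obtain ⟨x, hx, hxi⟩ : ∃ x, (∀ j ∈ J.erase i, mink (P.e j) x ≤ 0) ∧ 0 < mink (P.e i) x := by
    by_contra! hcon
    refine Finset.notMem_erase i J (hmin (fun x hx => hJ x fun j hj => ?_)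
      (Finset.erase_subset i J) hi)
    by_cases hji : j = i
    · exact hji ▸ hcon x hx
    · exact hx j (Finset.mem_erase.2 ⟨hji, hj⟩)
  obtain ⟨p, -, hp⟩ := P.exists_forall_mink_neg
  obtain ⟨t, ht, hti⟩ := exists_pos_add_mul_neg {i} (fun k => -mink (P.e k) x)
    (fun k => -mink (P.e k) (chartLift p))
  have hti' := hti i (Finset.mem_singleton_self i) (neg_lt_zero.2 hxi)
  refine ⟨x + t • chartLift p, ?_, fun j hj hji => ?_⟩
  · rw [mink_add_right, mink_smul_right]
    linarith
  · rw [mink_add_right, mink_smul_right]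
    nlinarith [hx j (Finset.mem_erase.2 ⟨hji, hj⟩), mul_neg_of_pos_of_neg ht (hp j)]

theorem IsCompactPoly.isExposed_inter (hP : P.IsCompactPoly) (i j : Fin P.m) :
    IsExposed ℝ P.cl {y ∈ P.cl | mink (P.e i) (chartLift y) = 0 ∧
      mink (P.e j) (chartLift y) = 0} := by
  rintro ⟨z, hz, hzi, hzj⟩
  refine ⟨innerSL ℝ (spatial (P.e i) + spatial (P.e j)), ?_⟩
  have hl : ∀ y, innerSL ℝ (spatial (P.e i) + spatial (P.e j)) y =
      mink (P.e i) (chartLift y) + mink (P.e j) (chartLift y) + (P.e i 0 + P.e j 0) := by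
    intro y
    rw [innerSL_apply_apply, inner_add_left, mink_chartLift, mink_chartLift]
    ring
  ext y
  simp only [Set.mem_ofPred_eq, hl]
  refine and_congr_right fun hy => ⟨fun ⟨hyi, hyj⟩ u hu => ?_, fun hmax => ?_⟩
  · have hu := hP.mem_cl_iff.1 hu
    linarith [hu i, hu j]
  · have := hmax z hz
    have hy := hP.mem_cl_iff.1 hy
    constructor <;> linarith [hy i, hy j]

theorem IsCompactPoly.isRightAngledCone (hP : P.IsCompactPoly) (hR : P.IsRightAngled)
    (hn : n ≠ 0) : ∃ J, IsRightAngledCone P.e J := by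
  obtain ⟨J, hJ, hirr⟩ := P.exists_irredundant
  obtain ⟨p, -, hp⟩ := P.exists_forall_mink_neg
  refine ⟨J, fun i _ => P.unit i, ⟨chartLift p, fun i _ => hp i⟩,
    fun x hne hx => hP.timelike hn hne (hJ x hx), hirr, ?_⟩
  intro i hi j hj hij x hne hx hix hjx hspan
  have hx0 := (hP.timelike hn hne (hJ x hx)).2
  have heq := smul_chartLift_kleinMap hx0.ne'
  set y := kleinMap x
  have hval : ∀ k, mink (P.e k) x = x 0 * mink (P.e k) (chartLift y) := fun k => by
    rw [← mink_smul_right, heq]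
  have hzero : ∀ k, mink (P.e k) (chartLift y) = 0 → mink (P.e k) x = 0 := fun k hk => by
    rw [hval, hk, mul_zero]
  have hiy : mink (P.e i) (chartLift y) = 0 :=
    (mul_eq_zero.1 ((hval i).symm.trans hix)).resolve_left hx0.ne'
  have hjy : mink (P.e j) (chartLift y) = 0 :=
    (mul_eq_zero.1 ((hval j).symm.trans hjx)).resolve_left hx0.ne'
  have hy : ∀ k ∈ J, mink (P.e k) (chartLift y) ≤ 0 := fun k hk => by
    have := hx k hk
    rw [hval] at this
    nlinarith
  set F : Set (EuclideanSpace ℝ (Fin n)) := {y ∈ P.cl | mink (P.e i) (chartLift y) = 0 ∧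
    mink (P.e j) (chartLift y) = 0}
  have hyF : y ∈ F := ⟨hP.mem_cl_iff.2 (hJ _ hy), hiy, hjy⟩
  obtain ⟨w, hiw, hw⟩ := hirr i hi
  have hli := linearIndependent_spatial_pair (hp i) (hp j) hiw (hw j hj hij.symm) hiy hjy
  have hvs : vectorSpan ℝ F =
      (Submodule.span ℝ (Set.range ![spatial (P.e i), spatial (P.e j)]))ᗮ := by
    have hmem : ∀ d, d ∈ (Submodule.span ℝ (Set.range ![spatial (P.e i), spatial (P.e j)]))ᗮ ↔
        inner ℝ (spatial (P.e i)) d = 0 ∧ inner ℝ (spatial (P.e j)) d = 0 := by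
      intro d
      rw [Matrix.range_cons, Matrix.range_cons, Matrix.range_empty, Set.union_empty,
        Set.singleton_union, Submodule.mem_orthogonal]
      refine ⟨fun h => ⟨h _ (Submodule.subset_span (by simp)),
        h _ (Submodule.subset_span (by simp))⟩, fun ⟨h1, h2⟩ u hu => ?_⟩
      obtain ⟨a, b, rfl⟩ := Submodule.mem_span_pair.1 hu
      rw [inner_add_left, real_inner_smul_left, real_inner_smul_left, h1, h2]
      ring
    apply le_antisymm
    · rw [vectorSpan_def, Submodule.span_le]
      rintro - ⟨u, ⟨-, hui, huj⟩, v, ⟨-, hvi, hvj⟩, rfl⟩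
      rw [mink_chartLift] at hui huj hvi hvj
      rw [SetLike.mem_coe, hmem]
      simp only [vsub_eq_sub, inner_sub_right]
      constructor <;> linarith
    · intro d hd
      rw [hmem] at hd
      obtain ⟨t, ht, htJ⟩ := exists_pos_add_mul_neg J (fun k => mink (P.e k) (chartLift y))
        (fun k => inner ℝ (spatial (P.e k)) d)
      have hydF : y + t • d ∈ F := by
        refine ⟨hP.mem_cl_iff.2 (hJ _ fun k hk => ?_), ?_, ?_⟩
        · rw [mink_chartLift_add]
          rcases (hy k hk).lt_or_eq with hlt | hk0
          · exact (htJ k hk hlt).le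
          · obtain ⟨a, b, hab⟩ := Submodule.mem_span_pair.1 (hspan k hk (hzero k hk0))
            rw [hk0, ← hab, spatial_smul_add_smul, inner_add_left, real_inner_smul_left,
              real_inner_smul_left, hd.1, hd.2]
            simp
        · rw [mink_chartLift_add, hiy, hd.1, mul_zero, add_zero]
        · rw [mink_chartLift_add, hjy, hd.2, mul_zero, add_zero]
      have htd := vsub_mem_vectorSpan ℝ hydF hyF
      rw [vsub_eq_sub, add_sub_cancel_left] at htd
      exact (Submodule.smul_mem_iff _ ht.ne').1 htd
  have hdim : sdim F = n - 2 := by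
    have hadd := Submodule.finrank_add_finrank_orthogonal
      (Submodule.span ℝ (Set.range ![spatial (P.e i), spatial (P.e j)]))
    rw [finrank_span_eq_card hli, finrank_euclideanSpace_fin, Fintype.card_fin] at hadd
    rw [sdim, hvs]
    omega
  have hcontains : ∀ k, (∀ u ∈ F, mink (P.e k) (chartLift u) = 0) →
      P.faceInHyperplane (P.e k) F := fun k hk v hv hvF => by
    rw [← smul_chartLift_kleinMap hv.1.2.ne', mink_smul_right, hk _ hvF, mul_zero]
  exact hR i j hij ⟨F, ⟨hP.isExposed_inter i j, ⟨y, hyF⟩, hdim⟩,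
    hcontains i fun u hu => hu.2.1, hcontains j fun u hu => hu.2.2⟩

end HypPolyhedron

/-- There are no compact right-angled convex hyperbolic polyhedra in `ℍⁿ` for `n ≥ 5`. -/
theorem no_compact_right_angled_polyhedron (n : ℕ) (hn : 5 ≤ n) :
    ¬ ∃ P : HypPolyhedron n, P.IsRightAngled ∧ P.IsCompactPoly := by
  rintro ⟨P, hR, hC⟩
  obtain ⟨J, hJ⟩ := hC.isRightAngledCone hR (by omega)
  exact hJ.false_of_five_le hn
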